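/- arXiv:1701.05512 — 12 statements merged into one kernel-verified Lean document; each statement's English description precedes it below -/
import Mathlib

section
/- For every measurable set H ∈ ℋ, it holds that a0·P0(Hᶜ) + a1·P1(H) ≥ a0·P0({x : a1·f1(x) ≥ a0·f0(x)}) + a1·P1({x : a1·f1(x) < a0·f0(x)}). In other words, the set {a1·f1 < a0·f0} minimizes the cost-weighted misclassification functional H ↦ a0·P0(Hᶜ) + a1·P1(H) over all measurable sets H. -/
open MeasureTheory
open scoped NNReal ENNReal

/-- The cost-weighted misclassification functional as a single integral. -/
theorem weighted_misclassification_eq_lintegral {Ω : Type*} [MeasurableSpace Ω] (μ : Measure Ω)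
    {f0 f1 : Ω → ℝ≥0∞} (hf0 : Measurable f0) (hf1 : Measurable f1) (c0 c1 : ℝ≥0∞)
    {S : Set Ω} (hS : MeasurableSet S) :
    c0 * μ.withDensity f0 Sᶜ + c1 * μ.withDensity f1 S =
      ∫⁻ x, S.indicator (fun y => c1 * f1 y) x + Sᶜ.indicator (fun y => c0 * f0 y) x ∂μ := by
  rw [lintegral_add_left ((hf1.const_mul c1).indicator hS), lintegral_indicator hS,
    lintegral_indicator hS.compl, lintegral_const_mul _ hf1, lintegral_const_mul _ hf0,
    withDensity_apply _ hS, withDensity_apply _ hS.compl, add_comm]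

/-- For every measurable set `H`, the cost-weighted misclassification
functional `H ↦ a0·P0(Hᶜ) + a1·P1(H)` is minimized by the set `{a1·f1 < a0·f0}`,
where `P0 = μ.withDensity f0` and `P1 = μ.withDensity f1` are probability measures. -/
theorem stmt_0 {Ω : Type*} [MeasurableSpace Ω] (μ : Measure Ω)
    (f0 f1 : Ω → ℝ≥0∞) (hf0 : Measurable f0) (hf1 : Measurable f1)
    (hP0 : IsProbabilityMeasure (μ.withDensity f0))
    (hP1 : IsProbabilityMeasure (μ.withDensity f1))
    (a0 a1 : ℝ≥0) (H : Set Ω) (hH : MeasurableSet H) :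
    (a0 : ℝ≥0∞) * μ.withDensity f0 Hᶜ + (a1 : ℝ≥0∞) * μ.withDensity f1 H ≥
      (a0 : ℝ≥0∞) * μ.withDensity f0 {x | (a0 : ℝ≥0∞) * f0 x ≤ (a1 : ℝ≥0∞) * f1 x} +
        (a1 : ℝ≥0∞) * μ.withDensity f1 {x | (a1 : ℝ≥0∞) * f1 x < (a0 : ℝ≥0∞) * f0 x} := by
  have hS : MeasurableSet {x | (a1 : ℝ≥0∞) * f1 x < (a0 : ℝ≥0∞) * f0 x} :=
    measurableSet_lt (hf1.const_mul _) (hf0.const_mul _)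
  have hSc : {x | (a0 : ℝ≥0∞) * f0 x ≤ (a1 : ℝ≥0∞) * f1 x} =
      {x | (a1 : ℝ≥0∞) * f1 x < (a0 : ℝ≥0∞) * f0 x}ᶜ := by
    ext x
    simp
  rw [ge_iff_le, hSc, weighted_misclassification_eq_lintegral μ hf0 hf1 _ _ hS,
    weighted_misclassification_eq_lintegral μ hf0 hf1 _ _ hH]
  refine lintegral_mono fun x => ?_
  by_cases hx : (a1 : ℝ≥0∞) * f1 x < (a0 : ℝ≥0∞) * f0 x <;> by_cases hxH : x ∈ H
  · simp [Set.indicator, hx, hxH]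
  · simpa [Set.indicator, hx, hxH] using hx.le
  · simpa [Set.indicator, hx, hxH] using not_lt.mp hx
  · simp [Set.indicator, hx, hxH]
end

section
/- For a measurable set H ∈ ℋ, equality a0·P0(Hᶜ) + a1·P1(H) = a0·P0({x : a1·f1(x) ≥ a0·f0(x)}) + a1·P1({x : a1·f1(x) < a0·f0(x)}) holds if and only if μ(H ∩ {x : a1·f1(x) > a0·f0(x)}) = 0 and μ(Hᶜ ∩ {x : a1·f1(x) < a0·f0(x)}) = 0. -/
open MeasureTheory
open scoped NNReal ENNReal

/-- Integrating `h` over `s` and `g` over `sᶜ` gives the (finite) integral of `min g h` exactly when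
`s` selects the smaller function almost everywhere. -/
theorem MeasureTheory.setLIntegral_compl_add_eq_lintegral_min_iff {α : Type*} [MeasurableSpace α]
    {μ : Measure α} {s : Set α} (hs : MeasurableSet s) {g h : α → ℝ≥0∞} (hg : Measurable g)
    (hh : Measurable h) (hfin : ∫⁻ x, min (g x) (h x) ∂μ ≠ ∞) :
    ∫⁻ x in sᶜ, g x ∂μ + ∫⁻ x in s, h x ∂μ = ∫⁻ x, min (g x) (h x) ∂μ ↔
      μ (s ∩ {x | g x < h x}) = 0 ∧ μ (sᶜ ∩ {x | h x < g x}) = 0 := by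
  classical
  have pointwise (x : α) : s.piecewise h g x = min (g x) (h x) ↔
      x ∉ s ∩ {x | g x < h x} ∧ x ∉ sᶜ ∩ {x | h x < g x} := by
    by_cases hx : x ∈ s <;> simp [hx]
  rw [add_comm, ← lintegral_piecewise hs, measure_eq_zero_iff_ae_notMem,
    measure_eq_zero_iff_ae_notMem, ← Filter.eventually_and]
  simp only [← pointwise]
  refine ⟨fun heq => ?_, lintegral_congr_ae⟩
  have hle : (fun x => min (g x) (h x)) ≤ᵐ[μ] s.piecewise h g := .of_forall fun x => by
    by_cases hx : x ∈ s <;> simp [hx]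
  exact (ae_eq_of_ae_le_of_lintegral_le hle hfin (hh.piecewise hs hg).aemeasurable heq.le).symm

/-- Equality in the cost-weighted misclassification bound holds
if and only if `μ(H ∩ {a1·f1 > a0·f0}) = 0` and `μ(Hᶜ ∩ {a1·f1 < a0·f0}) = 0`. -/
theorem stmt_1 {Ω : Type*} [MeasurableSpace Ω] (μ : Measure Ω)
    (f0 f1 : Ω → ℝ≥0∞) (hf0 : Measurable f0) (hf1 : Measurable f1)
    (hP0 : IsProbabilityMeasure (μ.withDensity f0))
    (hP1 : IsProbabilityMeasure (μ.withDensity f1))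
    (a0 a1 : ℝ≥0) (H : Set Ω) (hH : MeasurableSet H) :
    ((a0 : ℝ≥0∞) * μ.withDensity f0 Hᶜ + (a1 : ℝ≥0∞) * μ.withDensity f1 H =
      (a0 : ℝ≥0∞) * μ.withDensity f0 {x | (a0 : ℝ≥0∞) * f0 x ≤ (a1 : ℝ≥0∞) * f1 x} +
        (a1 : ℝ≥0∞) * μ.withDensity f1 {x | (a1 : ℝ≥0∞) * f1 x < (a0 : ℝ≥0∞) * f0 x})
    ↔ (μ (H ∩ {x | (a0 : ℝ≥0∞) * f0 x < (a1 : ℝ≥0∞) * f1 x}) = 0 ∧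
        μ (Hᶜ ∩ {x | (a1 : ℝ≥0∞) * f1 x < (a0 : ℝ≥0∞) * f0 x}) = 0) := by
  have mul_withDensity (a : ℝ≥0) {f : Ω → ℝ≥0∞} (hf : Measurable f) {s : Set Ω}
      (hs : MeasurableSet s) :
      (a : ℝ≥0∞) * μ.withDensity f s = ∫⁻ x in s, (a : ℝ≥0∞) * f x ∂μ := by
    rw [withDensity_apply _ hs, lintegral_const_mul _ hf]
  have hg : Measurable fun x => (a0 : ℝ≥0∞) * f0 x := hf0.const_mul _
  have hh : Measurable fun x => (a1 : ℝ≥0∞) * f1 x := hf1.const_mul _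
  have hfin : ∫⁻ x, min ((a0 : ℝ≥0∞) * f0 x) ((a1 : ℝ≥0∞) * f1 x) ∂μ ≠ ∞ := by
    refine ne_top_of_le_ne_top ?_ (lintegral_mono fun x => min_le_left _ _)
    rw [← setLIntegral_univ, ← mul_withDensity a0 hf0 .univ]
    simp
  have hlt : MeasurableSet {x | (a1 : ℝ≥0∞) * f1 x < (a0 : ℝ≥0∞) * f0 x} :=
    measurableSet_lt hh hg
  have hcompl : {x | (a0 : ℝ≥0∞) * f0 x ≤ (a1 : ℝ≥0∞) * f1 x} =
      {x | (a1 : ℝ≥0∞) * f1 x < (a0 : ℝ≥0∞) * f0 x}ᶜ := by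
    ext x; simp
  have hmin := (setLIntegral_compl_add_eq_lintegral_min_iff (μ := μ) hlt hg hh hfin).2 <| by
    constructor <;> convert measure_empty (μ := μ) using 2 <;> ext x <;> simp
    exact le_of_lt
  rw [hcompl, mul_withDensity a0 hf0 hH.compl, mul_withDensity a1 hf1 hH,
    mul_withDensity a0 hf0 hlt.compl, mul_withDensity a1 hf1 hlt, hmin]
  exact setLIntegral_compl_add_eq_lintegral_min_iff hH hg hh hfin
end

section
/- Suppose in addition that μ({x : a1·f1(x) = a0·f0(x)}) = 0. If H* ∈ ℋ is any measurable set with a0·P0((H*)ᶜ) + a1·P1(H*) = a0·P0({x : a1·f1(x) ≥ a0·f0(x)}) + a1·P1({x : a1·f1(x) < a0·f0(x)}), then the symmetric difference of H* and {x : a1·f1(x) < a0·f0(x)} is a μ-null set; that is, the minimizing set {a1·f1 < a0·f0} of the functional H ↦ a0·P0(Hᶜ) + a1·P1(H) is unique up to μ-null sets. -/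
open MeasureTheory
open scoped NNReal ENNReal

/-- The cost-weighted misclassification functional of a measurable set `S` is the integral of the
density equal to `a1 * f1` on `S` and to `a0 * f0` off `S`. -/
theorem mul_withDensity_compl_add_mul_withDensity {Ω : Type*} [MeasurableSpace Ω] (μ : Measure Ω)
    {f0 f1 : Ω → ℝ≥0∞} (hf0 : Measurable f0) (hf1 : Measurable f1) (a0 a1 : ℝ≥0∞)
    {S : Set Ω} (hS : MeasurableSet S) [DecidablePred (· ∈ S)] :
    a0 * μ.withDensity f0 Sᶜ + a1 * μ.withDensity f1 S =
      ∫⁻ x, S.piecewise (fun x ↦ a1 * f1 x) (fun x ↦ a0 * f0 x) x ∂μ := by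
  rw [withDensity_apply _ hS.compl, withDensity_apply _ hS, ← lintegral_const_mul _ hf0,
    ← lintegral_const_mul _ hf1, add_comm,
    ← lintegral_add_compl (S.piecewise _ _) hS]
  congr 1
  · exact setLIntegral_congr_fun hS fun x hx ↦ by simp [hx]
  · exact setLIntegral_congr_fun hS.compl fun x hx ↦ by simp [Set.piecewise, Set.notMem_of_mem_compl hx]

/-- If `μ({a1·f1 = a0·f0}) = 0`, then any measurable minimizer `H*` of the
cost-weighted misclassification functional coincides with `{a1·f1 < a0·f0}` up to a
`μ`-null set (symmetric difference is `μ`-null). -/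
theorem stmt_2 {Ω : Type*} [MeasurableSpace Ω] (μ : Measure Ω)
    (f0 f1 : Ω → ℝ≥0∞) (hf0 : Measurable f0) (hf1 : Measurable f1)
    (hP0 : IsProbabilityMeasure (μ.withDensity f0))
    (hP1 : IsProbabilityMeasure (μ.withDensity f1))
    (a0 a1 : ℝ≥0)
    (hnull : μ {x | (a1 : ℝ≥0∞) * f1 x = (a0 : ℝ≥0∞) * f0 x} = 0)
    (H : Set Ω) (hH : MeasurableSet H)
    (hmin : (a0 : ℝ≥0∞) * μ.withDensity f0 Hᶜ + (a1 : ℝ≥0∞) * μ.withDensity f1 H =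
      (a0 : ℝ≥0∞) * μ.withDensity f0 {x | (a0 : ℝ≥0∞) * f0 x ≤ (a1 : ℝ≥0∞) * f1 x} +
        (a1 : ℝ≥0∞) * μ.withDensity f1 {x | (a1 : ℝ≥0∞) * f1 x < (a0 : ℝ≥0∞) * f0 x}) :
    μ ((H \ {x | (a1 : ℝ≥0∞) * f1 x < (a0 : ℝ≥0∞) * f0 x}) ∪
        ({x | (a1 : ℝ≥0∞) * f1 x < (a0 : ℝ≥0∞) * f0 x} \ H)) = 0 := by
  classical
  set A : Set Ω := {x | (a1 : ℝ≥0∞) * f1 x < (a0 : ℝ≥0∞) * f0 x} with hA_def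
  have hg0 : Measurable fun x ↦ (a0 : ℝ≥0∞) * f0 x := hf0.const_mul _
  have hg1 : Measurable fun x ↦ (a1 : ℝ≥0∞) * f1 x := hf1.const_mul _
  have hA : MeasurableSet A := measurableSet_lt hg1 hg0
  have hAc : {x | (a0 : ℝ≥0∞) * f0 x ≤ (a1 : ℝ≥0∞) * f1 x} = Aᶜ := by
    ext x
    simp [hA_def]
  rw [hAc] at hmin
  have hfin : (a0 : ℝ≥0∞) * μ.withDensity f0 Aᶜ + (a1 : ℝ≥0∞) * μ.withDensity f1 A ≠ ∞ := by
    finiteness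
  rw [mul_withDensity_compl_add_mul_withDensity μ hf0 hf1 _ _ hA] at hmin hfin
  rw [mul_withDensity_compl_add_mul_withDensity μ hf0 hf1 _ _ hH] at hmin
  have hle : A.piecewise (fun x ↦ (a1 : ℝ≥0∞) * f1 x) (fun x ↦ (a0 : ℝ≥0∞) * f0 x) ≤
      H.piecewise (fun x ↦ (a1 : ℝ≥0∞) * f1 x) (fun x ↦ (a0 : ℝ≥0∞) * f0 x) := by
    intro x
    by_cases hxA : x ∈ A <;> by_cases hxH : x ∈ H <;>
      simp only [Set.piecewise, hxA, hxH, if_true, if_false, le_refl]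
    · exact hxA.le
    · exact not_lt.mp hxA
  have hae := ae_eq_of_ae_le_of_lintegral_le (ae_of_all μ hle) hfin
    (hg1.piecewise hH hg0).aemeasurable hmin.le
  refine measure_mono_null ?_ (measure_union_null hnull (ae_iff.mp hae))
  rintro x (⟨hxH, hxA⟩ | ⟨hxA, hxH⟩) <;> by_contra hx <;>
    simp_all [Set.piecewise, eq_comm]
end

section
/- If q_k ≤ q_{k+1} for some index k ≥ 0, then q_{k+1} ≤ q_{k+2}. Consequently, if q_0 ≤ q_1 then the CDE-Iterate sequence (q_k)_{k≥0} is non-decreasing. -/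
open MeasureTheory Filter

/-- For the CDE-Iterate sequence, `q k ≤ q (k+1)` implies
`q (k+1) ≤ q (k+2)`; consequently, if `q 0 ≤ q 1` then the sequence is non-decreasing. -/
theorem stmt_3 {Ω : Type*} [MeasurableSpace Ω]
    (Q : Measure Ω) [IsProbabilityMeasure Q]
    (f0 f1 : Ω → ℝ) (hf0m : Measurable f0) (hf1m : Measurable f1)
    (hf0 : ∀ x, 0 ≤ f0 x) (hf1 : ∀ x, 0 ≤ f1 x)
    (a0 a1 : ℝ) (ha0 : 0 < a0) (ha1 : 0 < a1)
    (q : ℕ → ℝ)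
    (hq0 : q 0 = (Q {x | a1 * f1 x < a0 * f0 x}).toReal)
    (hq : ∀ k, q (k + 1) = (Q {x | (1 - q k) * f1 x < q k * f0 x}).toReal) :
    (∀ k, q k ≤ q (k + 1) → q (k + 1) ≤ q (k + 2)) ∧
      (q 0 ≤ q 1 → Monotone q) := by
  have step : ∀ k, q k ≤ q (k + 1) → q (k + 1) ≤ q (k + 2) := by
    intro k h
    rw [hq k, hq (k + 1)]
    refine ENNReal.toReal_mono (measure_ne_top Q _) (measure_mono fun x hx => ?_)
    calc (1 - q (k + 1)) * f1 x ≤ (1 - q k) * f1 x :=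
          mul_le_mul_of_nonneg_right (by linarith) (hf1 x)
      _ < q k * f0 x := hx
      _ ≤ q (k + 1) * f0 x := mul_le_mul_of_nonneg_right h (hf0 x)
  refine ⟨step, fun h => monotone_nat_of_le_succ fun n => ?_⟩
  induction n with
  | zero => exact h
  | succ n ih => exact step n ih
end

section
/- If q_k ≥ q_{k+1} for some index k ≥ 0, then q_{k+1} ≥ q_{k+2}. Consequently, if q_0 ≥ q_1 then the CDE-Iterate sequence (q_k)_{k≥0} is non-increasing. -/
open MeasureTheory Filter

/-- For the CDE-Iterate sequence, `q k ≥ q (k+1)` implies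
`q (k+1) ≥ q (k+2)`; consequently, if `q 0 ≥ q 1` then the sequence is non-increasing. -/
theorem stmt_4 {Ω : Type*} [MeasurableSpace Ω]
    (Q : Measure Ω) [IsProbabilityMeasure Q]
    (f0 f1 : Ω → ℝ) (hf0m : Measurable f0) (hf1m : Measurable f1)
    (hf0 : ∀ x, 0 ≤ f0 x) (hf1 : ∀ x, 0 ≤ f1 x)
    (a0 a1 : ℝ) (ha0 : 0 < a0) (ha1 : 0 < a1)
    (q : ℕ → ℝ)
    (hq0 : q 0 = (Q {x | a1 * f1 x < a0 * f0 x}).toReal)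
    (hq : ∀ k, q (k + 1) = (Q {x | (1 - q k) * f1 x < q k * f0 x}).toReal) :
    (∀ k, q (k + 1) ≤ q k → q (k + 2) ≤ q (k + 1)) ∧
      (q 1 ≤ q 0 → Antitone q) := by
  have step : ∀ k, q (k + 1) ≤ q k → q (k + 2) ≤ q (k + 1) := by
    intro k hk
    have hsub : {x | (1 - q (k + 1)) * f1 x < q (k + 1) * f0 x} ⊆
        {x | (1 - q k) * f1 x < q k * f0 x} := fun x hx => by
      calc (1 - q k) * f1 x ≤ (1 - q (k + 1)) * f1 x :=
            mul_le_mul_of_nonneg_right (by linarith) (hf1 x)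
        _ < q (k + 1) * f0 x := hx
        _ ≤ q k * f0 x := mul_le_mul_of_nonneg_right hk (hf0 x)
    calc q (k + 2) = _ := hq (k + 1)
      _ ≤ _ := ENNReal.toReal_mono (measure_ne_top Q _) (measure_mono hsub)
      _ = q (k + 1) := (hq k).symm
  refine ⟨step, fun h => antitone_nat_of_succ_le fun n => ?_⟩
  induction n with
  | zero => exact h
  | succ n ih => exact step n ih
end

section
/- The CDE-Iterate sequence (q_k)_{k≥0} converges, i.e. the limit q* = lim_{k→∞} q_k exists in [0, 1], for any probability measure Q on (Ω, ℋ) and any choice of initial parameters a0 > 0 and a1 > 0. -/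
open MeasureTheory Filter Topology

/-- The update map of the CDE iteration is monotone. -/
theorem monotone_measure_odds_lt {Ω : Type*} [MeasurableSpace Ω]
    (Q : Measure Ω) [IsProbabilityMeasure Q] (f0 f1 : Ω → ℝ)
    (hf0 : ∀ x, 0 ≤ f0 x) (hf1 : ∀ x, 0 ≤ f1 x) :
    Monotone fun t : ℝ => (Q {x | (1 - t) * f1 x < t * f0 x}).toReal := by
  intro t s hts
  refine ENNReal.toReal_mono (measure_ne_top Q _) (measure_mono fun x hx => ?_)
  simp only [Set.mem_ofPred_eq] at hx ⊢
  have h0 := mul_le_mul_of_nonneg_right hts (hf0 x)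
  have h1 := mul_le_mul_of_nonneg_right hts (hf1 x)
  linarith

/-- The CDE-Iterate sequence converges: the limit exists in `[0, 1]`,
for any probability measure `Q` and any initial parameters `a0, a1 > 0`. -/
theorem stmt_5 {Ω : Type*} [MeasurableSpace Ω]
    (Q : Measure Ω) [IsProbabilityMeasure Q]
    (f0 f1 : Ω → ℝ) (hf0m : Measurable f0) (hf1m : Measurable f1)
    (hf0 : ∀ x, 0 ≤ f0 x) (hf1 : ∀ x, 0 ≤ f1 x)
    (a0 a1 : ℝ) (ha0 : 0 < a0) (ha1 : 0 < a1)
    (q : ℕ → ℝ)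
    (hq0 : q 0 = (Q {x | a1 * f1 x < a0 * f0 x}).toReal)
    (hq : ∀ k, q (k + 1) = (Q {x | (1 - q k) * f1 x < q k * f0 x}).toReal) :
    ∃ qs ∈ Set.Icc (0 : ℝ) 1, Tendsto q atTop (𝓝 qs) := by
  have hmem : ∀ k, q k ∈ Set.Icc (0 : ℝ) 1 := by
    intro k
    cases k with
    | zero => rw [hq0]; exact ⟨measureReal_nonneg, measureReal_le_one⟩
    | succ k => rw [hq k]; exact ⟨measureReal_nonneg, measureReal_le_one⟩
  have hG := monotone_measure_odds_lt Q f0 f1 hf0 hf1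
  have hlim : ∃ l, Tendsto q atTop (𝓝 l) := by
    rcases le_total (q 0) (q 1) with h | h
    · have hmono : Monotone q := by
        refine monotone_nat_of_le_succ fun n => ?_
        induction n with
        | zero => exact h
        | succ n ih => rw [hq n, hq (n + 1)]; exact hG ih
      exact ⟨_, tendsto_atTop_ciSup hmono ⟨1, Set.forall_mem_range.2 fun k => (hmem k).2⟩⟩
    · have hanti : Antitone q := by
        refine antitone_nat_of_succ_le fun n => ?_
        induction n with
        | zero => exact h
        | succ n ih => rw [hq n, hq (n + 1)]; exact hG ih
      exact ⟨_, tendsto_atTop_ciInf hanti ⟨0, Set.forall_mem_range.2 fun k => (hmem k).1⟩⟩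
  obtain ⟨l, hl⟩ := hlim
  exact ⟨l, isClosed_Icc.mem_of_tendsto hl (Eventually.of_forall hmem), hl⟩
end

section
/- If q_0 ≤ q_1, then the limit q* = lim_{k→∞} q_k of the CDE-Iterate sequence satisfies the fixed-point equation q* = Q({x : (1 − q*)·f1(x) < q*·f0(x)}). -/
open MeasureTheory Filter Topology

/-- The region `{x | (1 - t) * f1 x < t * f0 x}` grows with the threshold `t`. -/
lemma monotone_setOf_one_sub_mul_lt_mul {Ω : Type*} {f0 f1 : Ω → ℝ}
    (hf0 : ∀ x, 0 ≤ f0 x) (hf1 : ∀ x, 0 ≤ f1 x) :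
    Monotone fun t : ℝ => {x | (1 - t) * f1 x < t * f0 x} := by
  intro s t hst x hx
  simp only [Set.mem_ofPred_eq] at hx ⊢
  nlinarith [mul_nonneg (sub_nonneg.2 hst) (hf0 x), mul_nonneg (sub_nonneg.2 hst) (hf1 x)]

/-- Along an increasing sequence of thresholds, the regions exhaust the region of the limit. -/
lemma iUnion_setOf_one_sub_mul_lt_mul {Ω : Type*} {f0 f1 : Ω → ℝ}
    (hf0 : ∀ x, 0 ≤ f0 x) (hf1 : ∀ x, 0 ≤ f1 x) {u : ℕ → ℝ} (hu : Monotone u) {l : ℝ}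
    (hl : Tendsto u atTop (𝓝 l)) :
    ⋃ k, {x | (1 - u k) * f1 x < u k * f0 x} = {x | (1 - l) * f1 x < l * f0 x} := by
  refine Set.Subset.antisymm (Set.iUnion_subset fun k =>
    monotone_setOf_one_sub_mul_lt_mul hf0 hf1 (hu.ge_of_tendsto hl k)) fun x hx => ?_
  obtain ⟨k, hk⟩ := (((hl.const_sub 1).mul_const (f1 x)).eventually_lt
    (hl.mul_const (f0 x)) hx).exists
  exact Set.mem_iUnion.2 ⟨k, hk⟩

/-- If `q 0 ≤ q 1`, the limit `q*` of the CDE-Iterate sequence satisfies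
the fixed-point equation `q* = Q({x : (1 − q*)·f1 x < q*·f0 x})`. -/
theorem stmt_6 {Ω : Type*} [MeasurableSpace Ω]
    (Q : Measure Ω) [IsProbabilityMeasure Q]
    (f0 f1 : Ω → ℝ) (hf0m : Measurable f0) (hf1m : Measurable f1)
    (hf0 : ∀ x, 0 ≤ f0 x) (hf1 : ∀ x, 0 ≤ f1 x)
    (a0 a1 : ℝ) (ha0 : 0 < a0) (ha1 : 0 < a1)
    (q : ℕ → ℝ)
    (hq0 : q 0 = (Q {x | a1 * f1 x < a0 * f0 x}).toReal)
    (hq : ∀ k, q (k + 1) = (Q {x | (1 - q k) * f1 x < q k * f0 x}).toReal)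
    (h01 : q 0 ≤ q 1)
    (qs : ℝ) (hlim : Tendsto q atTop (𝓝 qs)) :
    qs = (Q {x | (1 - qs) * f1 x < qs * f0 x}).toReal := by
  have hmono := monotone_setOf_one_sub_mul_lt_mul hf0 hf1
  have hqmono : Monotone q := by
    refine monotone_nat_of_le_succ fun n => ?_
    induction n with
    | zero => exact h01
    | succ k ih =>
      rw [hq k, hq (k + 1)]
      exact ENNReal.toReal_mono (measure_ne_top Q _) (measure_mono (hmono ih))
  have hmeas := tendsto_measure_iUnion_atTop (μ := Q) (hmono.comp hqmono)
  simp only [Function.comp_apply] at hmeas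
  rw [iUnion_setOf_one_sub_mul_lt_mul hf0 hf1 hqmono hlim] at hmeas
  refine tendsto_nhds_unique ((tendsto_add_atTop_iff_nat 1).2 hlim) ?_
  simp only [hq]
  exact (ENNReal.tendsto_toReal (measure_ne_top Q _)).comp hmeas
end

section
/- If q_0 ≥ q_1 and q_k > q* for all k ≥ 0, where q* = lim_{k→∞} q_k is the limit of the CDE-Iterate sequence, then q* satisfies q* = Q({x : (1 − q*)·f1(x) ≤ q*·f0(x) and f0(x) + f1(x) > 0}). -/
open MeasureTheory Filter Topology

theorem setOf_one_sub_mul_lt_mul_mono {Ω : Type*} {f0 f1 : Ω → ℝ}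
    (hf0 : ∀ x, 0 ≤ f0 x) (hf1 : ∀ x, 0 ≤ f1 x) {c d : ℝ} (hcd : c ≤ d) :
    {x | (1 - c) * f1 x < c * f0 x} ⊆ {x | (1 - d) * f1 x < d * f0 x} := by
  intro x hx
  simp only [Set.mem_ofPred_eq] at hx ⊢
  have h := mul_le_mul_of_nonneg_right hcd (add_nonneg (hf0 x) (hf1 x))
  linarith

theorem iInter_setOf_one_sub_mul_lt_mul {Ω : Type*} {f0 f1 : Ω → ℝ}
    (hf0 : ∀ x, 0 ≤ f0 x) (hf1 : ∀ x, 0 ≤ f1 x) {q : ℕ → ℝ} {l : ℝ}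
    (hlim : Tendsto q atTop (𝓝 l)) (hlt : ∀ k, l < q k) :
    ⋂ k, {x | (1 - q k) * f1 x < q k * f0 x} =
      {x | (1 - l) * f1 x ≤ l * f0 x ∧ 0 < f0 x + f1 x} := by
  ext x
  simp only [Set.mem_iInter, Set.mem_ofPred_eq]
  constructor
  · intro h
    refine ⟨le_of_tendsto_of_tendsto' ((hlim.const_sub 1).mul_const _)
      (hlim.mul_const _) fun k => (h k).le, ?_⟩
    refine (add_nonneg (hf0 x) (hf1 x)).lt_of_ne fun h0 => ?_
    have h0x : f0 x = 0 := by linarith [hf0 x, hf1 x]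
    have h1x : f1 x = 0 := by linarith [hf0 x, hf1 x]
    simpa [h0x, h1x] using h 0
  · rintro ⟨hle, hpos⟩ k
    have h := mul_lt_mul_of_pos_right (hlt k) hpos
    linarith

/-- If `q 0 ≥ q 1` and `q k > q*` for all `k`, where `q*` is the limit of
the CDE-Iterate sequence, then
`q* = Q({x : (1 − q*)·f1 x ≤ q*·f0 x ∧ f0 x + f1 x > 0})`. -/
theorem stmt_7 {Ω : Type*} [MeasurableSpace Ω]
    (Q : Measure Ω) [IsProbabilityMeasure Q]
    (f0 f1 : Ω → ℝ) (hf0m : Measurable f0) (hf1m : Measurable f1)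
    (hf0 : ∀ x, 0 ≤ f0 x) (hf1 : ∀ x, 0 ≤ f1 x)
    (a0 a1 : ℝ) (ha0 : 0 < a0) (ha1 : 0 < a1)
    (q : ℕ → ℝ)
    (hq0 : q 0 = (Q {x | a1 * f1 x < a0 * f0 x}).toReal)
    (hq : ∀ k, q (k + 1) = (Q {x | (1 - q k) * f1 x < q k * f0 x}).toReal)
    (h01 : q 1 ≤ q 0)
    (qs : ℝ) (hlim : Tendsto q atTop (𝓝 qs))
    (hstrict : ∀ k, qs < q k) :
    qs = (Q {x | (1 - qs) * f1 x ≤ qs * f0 x ∧ 0 < f0 x + f1 x}).toReal := by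
  have hanti : Antitone q := by
    refine antitone_nat_of_succ_le fun n => ?_
    induction n with
    | zero => exact h01
    | succ k ih =>
      refine (hq (k + 1)).trans_le (le_of_le_of_eq ?_ (hq k).symm)
      refine ENNReal.toReal_mono (measure_ne_top Q _) (measure_mono ?_)
      exact setOf_one_sub_mul_lt_mul_mono hf0 hf1 ih
  have hmeas : ∀ k, NullMeasurableSet {x | (1 - q k) * f1 x < q k * f0 x} Q := fun k =>
    (measurableSet_lt (hf1m.const_mul _) (hf0m.const_mul _)).nullMeasurableSet
  have hinter := tendsto_measure_iInter_atTop hmeas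
    (fun _ _ hij => setOf_one_sub_mul_lt_mul_mono hf0 hf1 (hanti hij))
    ⟨0, measure_ne_top Q _⟩
  rw [iInter_setOf_one_sub_mul_lt_mul hf0 hf1 hlim hstrict] at hinter
  have hreal := (ENNReal.tendsto_toReal (measure_ne_top Q _)).comp hinter
  refine tendsto_nhds_unique ((tendsto_add_atTop_iff_nat 1).2 hlim) (hreal.congr fun k => ?_)
  exact (hq k).symm
end

section
/- If the CDE-Iterate sequence attains its limit at some index, i.e. q_k = q* for some k ≥ 0 where q* = lim_{j→∞} q_j, then q* satisfies the fixed-point equation q* = Q({x : (1 − q*)·f1(x) < q*·f0(x)}). -/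
open MeasureTheory Filter Topology

/-- The map `t ↦ Q({x : (1 − t)·f1 x < t·f0 x})` is monotone for nonnegative `f0`, `f1`. -/
theorem monotone_measure_threshold {Ω : Type*} [MeasurableSpace Ω]
    (Q : Measure Ω) [IsFiniteMeasure Q] {f0 f1 : Ω → ℝ}
    (hf0 : ∀ x, 0 ≤ f0 x) (hf1 : ∀ x, 0 ≤ f1 x) :
    Monotone fun t : ℝ => (Q {x | (1 - t) * f1 x < t * f0 x}).toReal := by
  intro s t hst
  refine ENNReal.toReal_mono (measure_ne_top _ _) (measure_mono fun x hx => ?_)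
  have h0 := mul_le_mul_of_nonneg_right hst (hf0 x)
  have h1 := mul_le_mul_of_nonneg_right (sub_le_sub_left hst 1) (hf1 x)
  exact h1.trans_lt (lt_of_lt_of_le hx h0)

/-- If an orbit of a monotone map attains its limit, then the limit is a fixed point. -/
theorem Monotone.map_eq_of_orbit_attains_limit {α : Type*} [LinearOrder α] [TopologicalSpace α]
    [OrderClosedTopology α] {T : α → α} (hT : Monotone T) {q : ℕ → α}
    (hq : ∀ k, q (k + 1) = T (q k)) {l : α} (hlim : Tendsto q atTop (𝓝 l)) {k : ℕ}
    (hk : q k = l) : T l = l := by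
  have hstep : q (k + 1) = T l := by rw [hq, hk]
  rcases le_total (q 0) (q 1) with h | h
  · have hmono : Monotone q := monotone_nat_of_le_succ fun n => by
      induction n with
      | zero => exact h
      | succ n ih => rw [hq n, hq (n + 1)]; exact hT ih
    rw [← hstep]
    exact le_antisymm (hmono.ge_of_tendsto hlim _) (hk ▸ hmono k.le_succ)
  · have hanti : Antitone q := antitone_nat_of_succ_le fun n => by
      induction n with
      | zero => exact h
      | succ n ih => rw [hq n, hq (n + 1)]; exact hT ih
    rw [← hstep]
    exact le_antisymm (hk ▸ hanti k.le_succ) (hanti.le_of_tendsto hlim _)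

/-- If the CDE-Iterate sequence attains its limit `q*` at some index,
then `q*` satisfies the fixed-point equation `q* = Q({x : (1 − q*)·f1 x < q*·f0 x})`. -/
theorem stmt_8 {Ω : Type*} [MeasurableSpace Ω]
    (Q : Measure Ω) [IsProbabilityMeasure Q]
    (f0 f1 : Ω → ℝ) (hf0m : Measurable f0) (hf1m : Measurable f1)
    (hf0 : ∀ x, 0 ≤ f0 x) (hf1 : ∀ x, 0 ≤ f1 x)
    (a0 a1 : ℝ) (ha0 : 0 < a0) (ha1 : 0 < a1)
    (q : ℕ → ℝ)
    (hq0 : q 0 = (Q {x | a1 * f1 x < a0 * f0 x}).toReal)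
    (hq : ∀ k, q (k + 1) = (Q {x | (1 - q k) * f1 x < q k * f0 x}).toReal)
    (qs : ℝ) (hlim : Tendsto q atTop (𝓝 qs))
    (hattain : ∃ k, q k = qs) :
    qs = (Q {x | (1 - qs) * f1 x < qs * f0 x}).toReal := by
  obtain ⟨k, hk⟩ := hattain
  exact ((monotone_measure_threshold Q hf0 hf1).map_eq_of_orbit_attains_limit hq hlim hk).symm
end

section
/- For every x ∈ ℝ, the right-hand limit of the function F(y) = Q({ω : f1(ω) < y·(f0(ω) + f1(ω))}) satisfies lim_{y↓x} F(y) = Q({ω : f1(ω) ≤ x·(f0(ω) + f1(ω)) and f0(ω) + f1(ω) > 0}). -/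
open MeasureTheory Filter Topology

/-- For every `x`, the right-hand limit of
`F y = Q({ω : f1 ω < y·(f0 ω + f1 ω)})` equals
`Q({ω : f1 ω ≤ x·(f0 ω + f1 ω) ∧ f0 ω + f1 ω > 0})`. -/
theorem stmt_10 {Ω : Type*} [MeasurableSpace Ω]
    (Q : Measure Ω) [IsProbabilityMeasure Q]
    (f0 f1 : Ω → ℝ) (hf0m : Measurable f0) (hf1m : Measurable f1)
    (hf0 : ∀ x, 0 ≤ f0 x) (hf1 : ∀ x, 0 ≤ f1 x)
    (x : ℝ) :
    Tendsto (fun y : ℝ => (Q {ω | f1 ω < y * (f0 ω + f1 ω)}).toReal)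
      (nhdsWithin x (Set.Ioi x))
      (𝓝 ((Q {ω | f1 ω ≤ x * (f0 ω + f1 ω) ∧ 0 < f0 ω + f1 ω}).toReal)) := by
  have hlt (y : ℝ) : MeasurableSet {ω | f1 ω < y * (f0 ω + f1 ω)} :=
    measurableSet_lt hf1m ((hf0m.add hf1m).const_mul y)
  refine (ENNReal.tendsto_toReal (measure_ne_top Q _)).comp
    (tendsto_measure_of_tendsto_indicator_of_isFiniteMeasure (𝓝[>] x) Q hlt fun ω => ?_)
  simp only [Set.mem_ofPred_eq]
  rcases (add_nonneg (hf0 ω) (hf1 ω)).eq_or_lt with hs | hs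
  · have h1 : ¬ f1 ω < 0 := (hf1 ω).not_gt
    simp [← hs, h1]
  · by_cases h : f1 ω ≤ x * (f0 ω + f1 ω)
    · filter_upwards [self_mem_nhdsWithin] with y hy
      exact iff_of_true (h.trans_lt (mul_lt_mul_of_pos_right hy hs)) ⟨h, hs⟩
    · have hcont : Tendsto (fun y : ℝ => y * (f0 ω + f1 ω)) (𝓝[>] x)
          (𝓝 (x * (f0 ω + f1 ω))) :=
        (tendsto_id.mul_const _).mono_left nhdsWithin_le_nhds
      filter_upwards [hcont.eventually_lt_const (not_le.mp h)] with y hy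
      exact iff_of_false hy.not_gt fun h' => h h'.1
end

section
/- Under an 'invariant density ratio'-type dataset shift, the true test-set prevalence of class 0 solves the EM-algorithm (maximum-likelihood) equation: with R = f0/f1 the training density ratio, Q = q·Q0 + (1−q)·Q1 the test-set feature distribution with true class-0 prevalence q ∈ (0,1), and the ratio invariance f0/f1 = h0/h1 holding μ-almost everywhere, one has ∫ (R(x) − 1)/(1 + q·(R(x) − 1)) dQ(x) = 0. In particular, the EM-algorithm estimator, defined as the solution in (0,1) of this equation, is Fisher consistent for the prevalence of class 0 in the family of test distributions related to the training distribution by 'invariant density ratio'-type dataset shift (and hence also in the subfamily given by prior probability shift). -/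
open MeasureTheory Filter Topology

/-- A nonnegative measurable density of a probability measure is integrable. -/
theorem integrable_of_isProbabilityMeasure_withDensity {Ω : Type*} [MeasurableSpace Ω]
    {μ : Measure Ω} {h : Ω → ℝ} (hm : Measurable h) (hpos : ∀ x, 0 ≤ h x)
    (hQ : IsProbabilityMeasure (μ.withDensity fun x => ENNReal.ofReal (h x))) :
    Integrable h μ := by
  have hlint : ∫⁻ x, ENNReal.ofReal (h x) ∂μ = 1 := by
    rw [← setLIntegral_univ, ← withDensity_apply _ MeasurableSet.univ, hQ.measure_univ]
  refine ⟨hm.aestronglyMeasurable, ?_⟩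
  rw [hasFiniteIntegral_iff_ofReal (ae_of_all _ hpos), hlint]
  exact ENNReal.one_lt_top

/-- A nonnegative measurable density of a probability measure integrates to one. -/
theorem integral_eq_one_of_isProbabilityMeasure_withDensity {Ω : Type*} [MeasurableSpace Ω]
    {μ : Measure Ω} {h : Ω → ℝ} (hm : Measurable h) (hpos : ∀ x, 0 ≤ h x)
    (hQ : IsProbabilityMeasure (μ.withDensity fun x => ENNReal.ofReal (h x))) :
    ∫ x, h x ∂μ = 1 := by
  have hlint : ∫⁻ x, ENNReal.ofReal (h x) ∂μ = 1 := by
    rw [← setLIntegral_univ, ← withDensity_apply _ MeasurableSet.univ, hQ.measure_univ]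
  rw [integral_eq_lintegral_of_nonneg_ae (ae_of_all _ hpos) hm.aestronglyMeasurable, hlint,
    ENNReal.toReal_one]

/-- A mixture of two measures with densities has the mixture of the densities as density. -/
theorem smul_withDensity_add_smul_withDensity {Ω : Type*} [MeasurableSpace Ω]
    (μ : Measure Ω) {g h : Ω → ℝ} (hgm : Measurable g) (hhm : Measurable h)
    (hg : ∀ x, 0 ≤ g x) (hh : ∀ x, 0 ≤ h x) {a b : ℝ} (ha : 0 ≤ a) (hb : 0 ≤ b) :
    ENNReal.ofReal a • μ.withDensity (fun x => ENNReal.ofReal (g x)) +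
        ENNReal.ofReal b • μ.withDensity (fun x => ENNReal.ofReal (h x)) =
      μ.withDensity fun x => ENNReal.ofReal (a * g x + b * h x) := by
  rw [← withDensity_smul _ hgm.ennreal_ofReal, ← withDensity_smul _ hhm.ennreal_ofReal,
    ← withDensity_add_left (hgm.ennreal_ofReal.const_smul _)]
  congr 1
  funext x
  simp only [Pi.add_apply, Pi.smul_apply, smul_eq_mul]
  rw [ENNReal.ofReal_add (mul_nonneg ha (hg x)) (mul_nonneg hb (hh x)),
    ENNReal.ofReal_mul ha, ENNReal.ofReal_mul hb]

/-- Under an 'invariant density ratio'-type dataset shift, the true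
test-set class-0 prevalence `q` solves the EM-algorithm (maximum likelihood) equation
`∫ (R − 1)/(1 + q·(R − 1)) dQ = 0`, where `R = f0/f1` is the training density ratio and
`Q = q·Q0 + (1−q)·Q1` is the test-set feature distribution.  Hence the EM estimator is
Fisher consistent for the class-0 prevalence under 'invariant density ratio' shift. -/
theorem stmt_11 {Ω : Type*} [MeasurableSpace Ω] (μ : Measure Ω)
    (f0 f1 h0 h1 : Ω → ℝ)
    (hf0m : Measurable f0) (hf1m : Measurable f1)
    (hh0m : Measurable h0) (hh1m : Measurable h1)
    (hf0 : ∀ x, 0 < f0 x) (hf1 : ∀ x, 0 < f1 x)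
    (hh0 : ∀ x, 0 < h0 x) (hh1 : ∀ x, 0 < h1 x)
    (hP0 : IsProbabilityMeasure (μ.withDensity fun x => ENNReal.ofReal (f0 x)))
    (hP1 : IsProbabilityMeasure (μ.withDensity fun x => ENNReal.ofReal (f1 x)))
    (hQ0 : IsProbabilityMeasure (μ.withDensity fun x => ENNReal.ofReal (h0 x)))
    (hQ1 : IsProbabilityMeasure (μ.withDensity fun x => ENNReal.ofReal (h1 x)))
    (hinv : ∀ᵐ x ∂μ, f0 x / f1 x = h0 x / h1 x)
    (q : ℝ) (hq0 : 0 < q) (hq1 : q < 1) :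
    ∫ x, (f0 x / f1 x - 1) / (1 + q * (f0 x / f1 x - 1))
        ∂(ENNReal.ofReal q • μ.withDensity (fun x => ENNReal.ofReal (h0 x)) +
          ENNReal.ofReal (1 - q) • μ.withDensity (fun x => ENNReal.ofReal (h1 x))) = 0 := by
  have hq1' : 0 < 1 - q := sub_pos.2 hq1
  have hdens : ∀ x, 0 < q * h0 x + (1 - q) * h1 x := fun x =>
    add_pos (mul_pos hq0 (hh0 x)) (mul_pos hq1' (hh1 x))
  rw [smul_withDensity_add_smul_withDensity μ hh0m hh1m (fun x => (hh0 x).le)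
      (fun x => (hh1 x).le) hq0.le hq1'.le,
    integral_withDensity_eq_integral_toReal_smul (by fun_prop)
      (ae_of_all _ fun _ => ENNReal.ofReal_lt_top)]
  have hae : (fun x => (ENNReal.ofReal (q * h0 x + (1 - q) * h1 x)).toReal •
      ((f0 x / f1 x - 1) / (1 + q * (f0 x / f1 x - 1)))) =ᵐ[μ] fun x => h0 x - h1 x := by
    filter_upwards [hinv] with x hx
    have h1ne : h1 x ≠ 0 := (hh1 x).ne'
    have hden : 1 + q * (h0 x / h1 x - 1) = (q * h0 x + (1 - q) * h1 x) / h1 x := by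
      field_simp
      ring
    have hne := (hdens x).ne'
    rw [hx, hden, ENNReal.toReal_ofReal (hdens x).le, smul_eq_mul, div_div_eq_mul_div,
      mul_div_cancel₀ _ hne, sub_mul, div_mul_cancel₀ _ h1ne, one_mul]
  rw [integral_congr_ae hae,
    integral_sub
      (integrable_of_isProbabilityMeasure_withDensity hh0m (fun x => (hh0 x).le) hQ0)
      (integrable_of_isProbabilityMeasure_withDensity hh1m (fun x => (hh1 x).le) hQ1),
    integral_eq_one_of_isProbabilityMeasure_withDensity hh0m (fun x => (hh0 x).le) hQ0,
    integral_eq_one_of_isProbabilityMeasure_withDensity hh1m (fun x => (hh1 x).le) hQ1,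
    sub_self]
end

section
/- The function φ : (0,1) → ℝ defined by φ(q) = ∫ (R(x) − 1)/(1 + q·(R(x) − 1)) dQ(x) is strictly decreasing on (0,1) whenever Q({x : R(x) ≠ 1}) > 0; consequently, the equation ∫ (R(x) − 1)/(1 + q·(R(x) − 1)) dQ(x) = 0 has at most one solution q in the open interval (0,1). -/
open MeasureTheory Filter Topology

/-- The denominator `1 + q (r − 1)` is the convex combination `(1 − q) + q r`. -/
lemma one_add_mul_sub_one_pos {q r : ℝ} (hq : q ∈ Set.Ioo (0 : ℝ) 1) (hr : 0 < r) :
    0 < 1 + q * (r - 1) := by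
  nlinarith [mul_pos hq.1 hr, hq.2]

lemma sub_one_div_sub_sub_one_div {a b r : ℝ} (ha : a ∈ Set.Ioo (0 : ℝ) 1)
    (hb : b ∈ Set.Ioo (0 : ℝ) 1) (hr : 0 < r) :
    (r - 1) / (1 + a * (r - 1)) - (r - 1) / (1 + b * (r - 1)) =
      (b - a) * (r - 1) ^ 2 / ((1 + a * (r - 1)) * (1 + b * (r - 1))) := by
  rw [div_sub_div _ _ (one_add_mul_sub_one_pos ha hr).ne' (one_add_mul_sub_one_pos hb hr).ne']
  ring

/-- For fixed `r ≠ 1` the integrand is strictly decreasing in `q`. -/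
lemma sub_one_div_lt_sub_one_div {a b r : ℝ} (ha : a ∈ Set.Ioo (0 : ℝ) 1)
    (hb : b ∈ Set.Ioo (0 : ℝ) 1) (hab : a < b) (hr : 0 < r) (hr1 : r ≠ 1) :
    (r - 1) / (1 + b * (r - 1)) < (r - 1) / (1 + a * (r - 1)) := by
  rw [← sub_pos, sub_one_div_sub_sub_one_div ha hb hr]
  have := one_add_mul_sub_one_pos ha hr
  have := one_add_mul_sub_one_pos hb hr
  have := sub_pos.2 hab
  have := sub_ne_zero.2 hr1
  positivity

/-- The function `φ q = ∫ (R − 1)/(1 + q·(R − 1)) dQ` is strictly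
decreasing on `(0,1)` whenever `Q({R ≠ 1}) > 0`; consequently, the equation `φ q = 0`
has at most one solution `q ∈ (0,1)`. -/
theorem stmt_12 {Ω : Type*} [MeasurableSpace Ω]
    (Q : Measure Ω) [IsProbabilityMeasure Q]
    (R : Ω → ℝ) (hRm : Measurable R) (hRpos : ∀ x, 0 < R x)
    (hint : ∀ q ∈ Set.Ioo (0 : ℝ) 1,
      Integrable (fun x => (R x - 1) / (1 + q * (R x - 1))) Q)
    (hQ : 0 < Q {x | R x ≠ 1}) :
    StrictAntiOn (fun q : ℝ => ∫ x, (R x - 1) / (1 + q * (R x - 1)) ∂Q)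
        (Set.Ioo (0 : ℝ) 1) ∧
      ∀ q₁ ∈ Set.Ioo (0 : ℝ) 1, ∀ q₂ ∈ Set.Ioo (0 : ℝ) 1,
        (∫ x, (R x - 1) / (1 + q₁ * (R x - 1)) ∂Q) = 0 →
        (∫ x, (R x - 1) / (1 + q₂ * (R x - 1)) ∂Q) = 0 → q₁ = q₂ := by
  have anti : StrictAntiOn (fun q : ℝ => ∫ x, (R x - 1) / (1 + q * (R x - 1)) ∂Q)
      (Set.Ioo (0 : ℝ) 1) := by
    intro a ha b hb hab
    have lt_of_ne : ∀ x, R x ≠ 1 →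
        (R x - 1) / (1 + b * (R x - 1)) < (R x - 1) / (1 + a * (R x - 1)) :=
      fun x => sub_one_div_lt_sub_one_div ha hb hab (hRpos x)
    rw [← sub_pos, ← integral_sub (hint a ha) (hint b hb)]
    refine (integral_pos_iff_support_of_nonneg ?_ ((hint a ha).sub (hint b hb))).2 ?_
    · intro x
      by_cases hx : R x = 1
      · simp [hx]
      · exact (sub_pos.2 (lt_of_ne x hx)).le
    · exact hQ.trans_le (measure_mono fun x hx => (sub_pos.2 (lt_of_ne x hx)).ne')
  exact ⟨anti, fun q₁ h₁ q₂ h₂ e₁ e₂ => anti.injOn h₁ h₂ (e₁.trans e₂.symm)⟩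
end
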